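/- For every integer n ≥ 1, eb(n,2) = (2n+1)/12 + 3/(4(2n−1)); equivalently, db(n,2) = 3/(4(2n−1)). -/

import Mathlib

open scoped Classical

/-- A deal of size `n` is a fixed-point-free involution of `Fin (2*n)`. -/
def IsDeal (n : ℕ) (π : Fin (2*n) → Fin (2*n)) : Prop :=
  ∀ j, π (π j) = j ∧ π j ≠ j

/-- The finite set `D_n` of all deals of size `n`. -/
noncomputable def deals (n : ℕ) : Finset (Fin (2*n) → Fin (2*n)) :=
  Finset.univ.filter (IsDeal n)

/-- The second occurrences of `π` (positions `j` with `π j < j`), in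
increasing order: `j_1 < j_2 < ... < j_n`. -/
def blockEnds {n : ℕ} (π : Fin (2*n) → Fin (2*n)) : List (Fin (2*n)) :=
  (Finset.univ.filter (fun j => π j < j)).sort (· ≤ ·)

/-- The block lengths `b_1, ..., b_n` of a deal:
`b_1 = j_1 + 1` and `b_i = j_i - j_(i-1)` for `i ≥ 2`. -/
def blockLens {n : ℕ} (π : Fin (2*n) → Fin (2*n)) : List ℕ :=
  List.zipWith (fun x y => x - y)
    ((blockEnds π).map (fun j => (j : ℕ) + 1))
    (0 :: (blockEnds π).map (fun j => (j : ℕ) + 1))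

/-- The blocks of a deal: each block length `b_i` paired with the ending
position `j_i` of the block. -/
def blocks {n : ℕ} (π : Fin (2*n) → Fin (2*n)) : List (ℕ × Fin (2*n)) :=
  List.zip (blockLens π) (blockEnds π)

/-- The `i`-th block (ending at position `j_i`) is lucky if `π j_i = j_i - 1`. -/
def IsLuckyEnd {n : ℕ} (π : Fin (2*n) → Fin (2*n)) (j : Fin (2*n)) : Prop :=
  (π j).val = (j : ℕ) - 1

/-- `b(n,j)`: total number of blocks of length `j` over all deals in `D_n`. -/
noncomputable def bcount (n j : ℕ) : ℕ :=
  ∑ π ∈ deals n, (blockLens π).count j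

/-- `l(n,j)`: total number of lucky blocks of length `j` over all deals in `D_n`. -/
noncomputable def lcount (n j : ℕ) : ℕ :=
  ∑ π ∈ deals n, (blocks π).countP (fun p => decide (p.1 = j ∧ IsLuckyEnd π p.2))

/-- `eb(n,j)`: the expected number of blocks of length `j` in a random deal. -/
noncomputable def eb (n j : ℕ) : ℝ := (bcount n j : ℝ) / ((deals n).card : ℝ)

/-- `el(n,j)`: the expected number of lucky blocks of length `j` in a random deal. -/
noncomputable def el (n j : ℕ) : ℝ := (lcount n j : ℝ) / ((deals n).card : ℝ)

/-- `db(n,j) = eb(n,j) - 2(2n+1)/(j(j+1)(j+2))`. -/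
noncomputable def db (n j : ℕ) : ℝ :=
  eb n j - 2*(2*(n:ℝ)+1) / ((j:ℝ) * ((j:ℝ)+1) * ((j:ℝ)+2))

/-- `dl(n,j) = el(n,j) - 1/(j(j-1))`. -/
noncomputable def dl (n j : ℕ) : ℝ :=
  el n j - 1 / ((j:ℝ) * ((j:ℝ)-1))

/-- `e(π)`: the number of blocks of `π` of even length. -/
noncomputable def evenBlocks {n : ℕ} (π : Fin (2*n) → Fin (2*n)) : ℕ :=
  (blockLens π).countP (fun b => decide (Even b))

/-- `l(π)`: the number of even-length lucky blocks of `π`. -/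
noncomputable def luckyEvenBlocks {n : ℕ} (π : Fin (2*n) → Fin (2*n)) : ℕ :=
  (blocks π).countP (fun p => decide (Even p.1 ∧ IsLuckyEnd π p.2))

theorem mem_deals {n : ℕ} {π : Fin (2*n) → Fin (2*n)} : π ∈ deals n ↔ IsDeal n π := by
  simp [deals]

theorem IsDeal.injective {n : ℕ} {π : Fin (2*n) → Fin (2*n)} (h : IsDeal n π) :
    Function.Injective π :=
  Function.LeftInverse.injective fun j => (h j).1

theorem IsDeal.conj {n : ℕ} {π : Fin (2*n) → Fin (2*n)} (h : IsDeal n π)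
    (σ : Equiv.Perm (Fin (2*n))) : IsDeal n (fun j => σ (π (σ.symm j))) := by
  intro j
  refine ⟨by simp [(h _).1], fun e => (h (σ.symm j)).2 ?_⟩
  rw [Equiv.eq_symm_apply]
  exact e

theorem deals_nonempty (n : ℕ) : (deals n).Nonempty := by
  refine ⟨Fin.rev, mem_deals.2 fun j => ⟨Fin.rev_rev j, fun e => ?_⟩⟩
  have := congrArg Fin.val e
  rw [Fin.val_rev] at this
  omega

theorem card_eq_card_mul_of_fiber {ι κ : Type*} [DecidableEq κ] {A : Finset ι} (f : ι → κ)
    {T : Finset κ} {m : ℝ} (hA : ∀ π ∈ A, f π ∈ T)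
    (h : ∀ d ∈ T, ((A.filter (fun π => f π = d)).card : ℝ) = m) :
    (A.card : ℝ) = T.card * m := by
  rw [Finset.card_eq_sum_card_fiberwise (f := f) (t := T) hA]
  push_cast
  rw [Finset.sum_congr rfl h]
  simp

/-- In a family of deals that is stable under swapping the possible partners of `c`, all
these partners are equally frequent. -/
theorem card_eq_card_mul_fiber {n : ℕ} {A : Finset (Fin (2*n) → Fin (2*n))}
    {T : Finset (Fin (2*n))} {c d : Fin (2*n)} (hd : d ∈ T) (hc : c ∉ T)
    (hA : ∀ π ∈ A, π c ∈ T)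
    (hconj : ∀ d ∈ T, ∀ d' ∈ T, ∀ π ∈ A,
      (fun j => Equiv.swap d d' (π ((Equiv.swap d d').symm j))) ∈ A) :
    (A.card : ℝ) = T.card * (A.filter (fun π => π c = d)).card := by
  refine card_eq_card_mul_of_fiber (fun π => π c) hA fun d' hd' => ?_
  have key : ∀ e ∈ T, ∀ e' ∈ T, (A.filter (fun π => π c = e)).card ≤
      (A.filter (fun π => π c = e')).card := by
    intro e he e' he'
    refine Finset.card_le_card_of_injOn
      (fun π j => Equiv.swap e e' (π ((Equiv.swap e e').symm j))) ?_ ?_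
    · intro π hπ
      simp only [Finset.coe_filter, Set.mem_ofPred_eq] at hπ ⊢
      refine ⟨hconj e he e' he' π hπ.1, ?_⟩
      rw [Equiv.symm_swap, Equiv.swap_apply_of_ne_of_ne (a := e) (b := e') (x := c)
        (fun h => hc (h ▸ he)) (fun h => hc (h ▸ he')), hπ.2, Equiv.swap_apply_left]
    · intro π _ ρ _ h
      funext j
      have := congrFun h (Equiv.swap e e' j)
      simpa using this
  exact_mod_cast (key d' hd' d hd).antisymm (key d hd d' hd')

theorem card_deals_eq {n : ℕ} {a b : Fin (2*n)} (hab : a ≠ b) :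
    ((deals n).card : ℝ) = (2*n - 1) * ((deals n).filter (fun π => π a = b)).card := by
  have hT : (({a} : Finset (Fin (2*n)))ᶜ.card : ℝ) = 2*n - 1 := by
    have := Finset.card_add_card_compl ({a} : Finset (Fin (2*n)))
    rw [Finset.card_singleton, Fintype.card_fin] at this
    have : ((1 + ({a} : Finset (Fin (2*n)))ᶜ.card : ℕ) : ℝ) = (2*n : ℕ) := by rw [this]
    push_cast at this
    linarith
  rw [← hT]
  refine card_eq_card_mul_fiber (by simpa using hab.symm) (by simp) ?_ ?_
  · intro π hπ
    simpa using (mem_deals.1 hπ a).2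
  · intro d _ d' _ π hπ
    exact mem_deals.2 ((mem_deals.1 hπ).conj _)

theorem card_deals_one_pair {n : ℕ} {a b c d : Fin (2*n)} (hnd : [a, b, c, d].Nodup) :
    (((deals n).filter (fun π => π a = b)).card : ℝ) =
      (2*n - 3) * ((deals n).filter (fun π => π a = b ∧ π c = d)).card := by
  simp only [List.nodup_cons, List.mem_cons, List.not_mem_nil, not_or, or_false] at hnd
  obtain ⟨⟨hab, hac, had⟩, ⟨hbc, hbd⟩, hcd, -⟩ := hnd
  have hT : (({a, b, c} : Finset (Fin (2*n)))ᶜ.card : ℝ) = 2*n - 3 := by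
    have := Finset.card_add_card_compl ({a, b, c} : Finset (Fin (2*n)))
    rw [Finset.card_eq_three.2 ⟨a, b, c, hab, hac, hbc, rfl⟩, Fintype.card_fin] at this
    have : ((3 + ({a, b, c} : Finset (Fin (2*n)))ᶜ.card : ℕ) : ℝ) = (2*n : ℕ) := by rw [this]
    push_cast at this
    linarith
  rw [← hT, ← Finset.filter_filter]
  refine card_eq_card_mul_fiber ?_ (by simp) ?_ ?_
  · simp only [Finset.mem_compl, Finset.mem_insert, Finset.mem_singleton, not_or]
    exact ⟨Ne.symm had, Ne.symm hbd, Ne.symm hcd⟩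
  · intro π hπ
    rw [Finset.mem_filter, mem_deals] at hπ
    obtain ⟨h, rfl⟩ := hπ
    simp only [Finset.mem_compl, Finset.mem_insert, Finset.mem_singleton, not_or]
    refine ⟨fun e => hbc ?_, fun e => hac (h.injective e).symm, (h c).2⟩
    rw [← e, (h c).1]
  · intro e he e' he' π hπ
    rw [Finset.mem_filter, mem_deals] at hπ ⊢
    simp only [Finset.mem_compl, Finset.mem_insert, Finset.mem_singleton, not_or] at he he'
    refine ⟨hπ.1.conj _, ?_⟩
    beta_reduce
    rw [Equiv.symm_swap, Equiv.swap_apply_of_ne_of_ne (x := a) (Ne.symm he.1) (Ne.symm he'.1),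
      hπ.2, Equiv.swap_apply_of_ne_of_ne (Ne.symm he.2.1) (Ne.symm he'.2.1)]

theorem card_deals_two_pairs {n : ℕ} {a b c d e f : Fin (2*n)}
    (hnd : [a, b, c, d, e, f].Nodup) :
    (((deals n).filter (fun π => π a = b ∧ π c = d)).card : ℝ) =
      (2*n - 5) * ((deals n).filter (fun π => (π a = b ∧ π c = d) ∧ π e = f)).card := by
  have hT : (({a, b, c, d, e} : Finset (Fin (2*n)))ᶜ.card : ℝ) = 2*n - 5 := by
    have := Finset.card_add_card_compl ({a, b, c, d, e} : Finset (Fin (2*n)))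
    have h5 : ({a, b, c, d, e} : Finset (Fin (2*n))).card = 5 := by
      have h := List.toFinset_card_of_nodup (l := [a, b, c, d, e])
        (hnd.sublist (by simp))
      simpa using h
    rw [h5, Fintype.card_fin] at this
    have : ((5 + ({a, b, c, d, e} : Finset (Fin (2*n)))ᶜ.card : ℕ) : ℝ) = (2*n : ℕ) := by
      rw [this]
    push_cast at this
    linarith
  simp only [List.nodup_cons, List.mem_cons, List.not_mem_nil, not_or, or_false] at hnd
  obtain ⟨⟨hab, hac, had, hae, haf⟩, ⟨hbc, hbd, hbe, hbf⟩, ⟨hcd, hce, hcf⟩,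
    ⟨hde, hdf⟩, hef, -⟩ := hnd
  have hfilter : (deals n).filter (fun π => (π a = b ∧ π c = d) ∧ π e = f) =
      ((deals n).filter (fun π => π a = b ∧ π c = d)).filter (fun π => π e = f) := by
    ext π
    simp [and_assoc]
  rw [← hT, hfilter]
  refine card_eq_card_mul_fiber ?_ (by simp) ?_ ?_
  · simp only [Finset.mem_compl, Finset.mem_insert, Finset.mem_singleton, not_or]
    exact ⟨Ne.symm haf, Ne.symm hbf, Ne.symm hcf, Ne.symm hdf, Ne.symm hef⟩
  · intro π hπ
    rw [Finset.mem_filter, mem_deals] at hπ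
    obtain ⟨h, rfl, rfl⟩ := hπ
    simp only [Finset.mem_compl, Finset.mem_insert, Finset.mem_singleton, not_or]
    refine ⟨fun e' => hbe ?_, fun e' => hae (h.injective e').symm, fun e' => hde ?_,
      fun e' => hce (h.injective e').symm, (h e).2⟩
    · rw [← e', (h e).1]
    · rw [← e', (h e).1]
  · intro x hx x' hx' π hπ
    rw [Finset.mem_filter, mem_deals] at hπ ⊢
    simp only [Finset.mem_compl, Finset.mem_insert, Finset.mem_singleton, not_or] at hx hx'
    refine ⟨hπ.1.conj _, ?_, ?_⟩
    · beta_reduce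
      rw [Equiv.symm_swap, Equiv.swap_apply_of_ne_of_ne (x := a) (Ne.symm hx.1) (Ne.symm hx'.1),
        hπ.2.1, Equiv.swap_apply_of_ne_of_ne (Ne.symm hx.2.1) (Ne.symm hx'.2.1)]
    · beta_reduce
      rw [Equiv.symm_swap, Equiv.swap_apply_of_ne_of_ne (x := c) (Ne.symm hx.2.2.1)
        (Ne.symm hx'.2.2.1), hπ.2.2,
        Equiv.swap_apply_of_ne_of_ne (Ne.symm hx.2.2.2.1) (Ne.symm hx'.2.2.2.1)]

theorem two_mul_sub_ne_zero (n : ℕ) {k : ℕ} (hk : Odd k) : (2*n - k : ℝ) ≠ 0 := by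
  obtain ⟨c, rfl⟩ := hk
  intro h
  have h' : ((2*n : ℕ) : ℝ) = (2*c + 1 : ℕ) := by push_cast at h ⊢; linarith
  have := Nat.cast_injective h'
  omega

theorem card_deals_pair_eq {n : ℕ} {a b : Fin (2*n)} (hab : a ≠ b) :
    (((deals n).filter (fun π => π a = b)).card : ℝ) = (deals n).card / (2*n - 1) := by
  have h1 : (2*n - 1 : ℝ) ≠ 0 := by simpa using two_mul_sub_ne_zero n (k := 1) (by decide)
  rw [card_deals_eq hab, mul_div_cancel_left₀ _ h1]

theorem card_deals_two_pairs_eq {n : ℕ} {a b c d : Fin (2*n)} (hnd : [a, b, c, d].Nodup) :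
    (((deals n).filter (fun π => π a = b ∧ π c = d)).card : ℝ) =
      (deals n).card / ((2*n - 1) * (2*n - 3)) := by
  have h3 : (2*n - 3 : ℝ) ≠ 0 := by simpa using two_mul_sub_ne_zero n (k := 3) (by decide)
  have hab : a ≠ b := by grind
  rw [← div_div, ← card_deals_pair_eq hab, card_deals_one_pair hnd, mul_div_cancel_left₀ _ h3]

theorem card_deals_three_pairs_eq {n : ℕ} {a b c d e f : Fin (2*n)}
    (hnd : [a, b, c, d, e, f].Nodup) :
    (((deals n).filter (fun π => (π a = b ∧ π c = d) ∧ π e = f)).card : ℝ) =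
      (deals n).card / ((2*n - 1) * (2*n - 3) * (2*n - 5)) := by
  have h5 : (2*n - 5 : ℝ) ≠ 0 := by simpa using two_mul_sub_ne_zero n (k := 5) (by decide)
  have h4 : [a, b, c, d].Nodup := hnd.sublist (by simp)
  rw [← div_div, ← card_deals_two_pairs_eq h4, card_deals_two_pairs hnd,
    mul_div_cancel_left₀ _ h5]

/-- Deals for which `k` ends a block and `k + 1`, `k + 2` are partners. -/
theorem card_deals_lucky {n : ℕ} {k l m : Fin (2*n)} (hl : l.val = k + 1) (hm : m.val = k + 2) :
    (((deals n).filter (fun π => π k < k ∧ π m = l)).card : ℝ) =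
      k * ((deals n).card / ((2*n - 1) * (2*n - 3))) := by
  rw [card_eq_card_mul_of_fiber (fun π => π k) (T := Finset.Iio k)
    (m := (deals n).card / ((2*n - 1) * (2*n - 3)))]
  · rw [Fin.card_Iio]
  · intro π hπ
    simpa using (Finset.mem_filter.1 hπ).2.1
  · intro a ha
    have ha : a < k := by simpa using ha
    rw [← card_deals_two_pairs_eq (a := k) (b := a) (c := m) (d := l), Finset.filter_filter]
    · congr 2
      ext π
      simp only [Finset.mem_filter, and_congr_right_iff]
      grind
    · simp only [List.nodup_cons, List.mem_cons, List.not_mem_nil, List.nodup_nil, or_false,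
      and_true, not_false_eq_true, Fin.ext_iff]
      omega

/-- Deals for which `k` and `k + 2` end blocks, `k + 1` does not, and `k + 1`, `k + 2` are not
partners. -/
theorem card_deals_unlucky {n : ℕ} {k l m : Fin (2*n)} (hl : l.val = k + 1)
    (hm : m.val = k + 2) :
    (((deals n).filter (fun π => π k < k ∧ π m < k ∧ m < π l)).card : ℝ) =
      k * ((k - 1) * ((2*n - 3 - k) *
        ((deals n).card / ((2*n - 1) * (2*n - 3) * (2*n - 5))))) := by
  rw [card_eq_card_mul_of_fiber (fun π => π k) (T := Finset.Iio k)
    (m := ((k - 1) * ((2*n - 3 - k) *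
        ((deals n).card / ((2*n - 1) * (2*n - 3) * (2*n - 5))))))]
  · rw [Fin.card_Iio]
  · intro π hπ
    simpa using (Finset.mem_filter.1 hπ).2.1
  intro a ha
  have hak : a < k := by simpa using ha
  rw [card_eq_card_mul_of_fiber (fun π => π m) (T := (Finset.Iio k).erase a)
    (m := ((2*n - 3 - k) * ((deals n).card / ((2*n - 1) * (2*n - 3) * (2*n - 5)))))]
  · rw [Finset.card_erase_of_mem ha, Fin.card_Iio, Nat.cast_sub (by omega), Nat.cast_one]
  · intro π hπ
    simp only [Finset.mem_filter, mem_deals] at hπ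
    simp only [Finset.mem_erase, Finset.mem_Iio]
    refine ⟨fun e => ?_, hπ.1.2.2.1⟩
    have := congrArg Fin.val (hπ.1.1.injective (e.trans hπ.2.symm))
    omega
  intro b hb
  obtain ⟨hba, hbk⟩ : b ≠ a ∧ b < k := by simpa using hb
  rw [card_eq_card_mul_of_fiber (fun π => π l) (T := Finset.Ioi m)
    (m := ((deals n).card / ((2*n - 1) * (2*n - 3) * (2*n - 5))))]
  · have := m.isLt
    rw [Fin.card_Ioi, hm, show 2*n - 1 - (k.val + 2) = 2*n - (k.val + 3) by omega,
      Nat.cast_sub (by omega)]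
    push_cast
    ring
  · intro π hπ
    simp only [Finset.mem_filter] at hπ
    simpa using hπ.1.1.2.2.2
  intro c hc
  have hmc : m < c := by simpa using hc
  rw [← card_deals_three_pairs_eq (a := k) (b := a) (c := m) (d := b) (e := l) (f := c)]
  · congr 2
    ext π
    simp only [Finset.mem_filter]
    grind
  · simp only [List.nodup_cons, List.mem_cons, List.not_mem_nil, List.nodup_nil, or_false,
      and_true, not_false_eq_true, Fin.ext_iff]
    simp only [Fin.lt_def, ne_eq, Fin.ext_iff] at *
    omega

/-- Deals with a block consisting of the positions `k + 1` and `k + 2`. -/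
theorem card_deals_block {n : ℕ} {k l m : Fin (2*n)} (hl : l.val = k + 1) (hm : m.val = k + 2) :
    (((deals n).filter (fun π => π k < k ∧ ¬ π l < l ∧ π m < m)).card : ℝ) =
      (k + k * (k - 1) * (2*n - 3 - k) / (2*n - 5)) *
        ((deals n).card / ((2*n - 1) * (2*n - 3))) := by
  have h1 : (2*n - 1 : ℝ) ≠ 0 := by simpa using two_mul_sub_ne_zero n (k := 1) (by decide)
  have h3 : (2*n - 3 : ℝ) ≠ 0 := by simpa using two_mul_sub_ne_zero n (k := 3) (by decide)
  have h5 : (2*n - 5 : ℝ) ≠ 0 := by simpa using two_mul_sub_ne_zero n (k := 5) (by decide)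
  have hsplit : (deals n).filter (fun π => π k < k ∧ ¬ π l < l ∧ π m < m) =
      (deals n).filter (fun π => π k < k ∧ π m = l) ∪
      (deals n).filter (fun π => π k < k ∧ π m < k ∧ m < π l) := by
    ext π
    simp only [Finset.mem_filter, Finset.mem_union, mem_deals]
    rw [← and_or_left]
    refine and_congr_right fun h => ?_
    have hk := h k
    have hl' := h l
    have hm' := h m
    simp only [Fin.lt_def, Fin.ext_iff, ne_eq] at *
    have e1 : (π m).val = k → π m = k := Fin.ext
    have e2 : (π l).val = m → π l = m := Fin.ext
    have e3 : (π m).val = l → π m = l := Fin.ext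
    constructor
    · rintro ⟨h1, h2, h3⟩
      by_cases h4 : (π m).val = l
      · exact .inl ⟨h1, h4⟩
      · refine .inr ⟨h1, ?_, ?_⟩ <;> grind
    · rintro (⟨h1, h2⟩ | ⟨h1, h2, h3⟩)
      · refine ⟨h1, ?_, ?_⟩ <;> grind
      · refine ⟨h1, ?_, ?_⟩ <;> omega
  rw [hsplit, Finset.card_union_of_disjoint]
  · push_cast
    rw [card_deals_lucky hl hm, card_deals_unlucky hl hm]
    field_simp [h1, h3, h5]
  · rw [Finset.disjoint_left]
    simp only [Finset.mem_filter, not_and, Fin.lt_def]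
    intro π h _ _ h'
    rw [h.2.2] at h'
    omega

theorem count_zipWith_sub_cons (L : List ℕ) (p : ℕ) (h : (p :: L).Pairwise (· < ·)) :
    (List.zipWith (fun x y => x - y) L (p :: L)).count 2 =
      L.countP (fun x => decide (2 ≤ x ∧ x - 2 ∈ p :: L ∧ x - 1 ∉ p :: L)) := by
  induction L generalizing p with
  | nil => simp
  | cons x L ih =>
    rw [List.zipWith_cons_cons, List.count_cons, ih x h.of_cons, List.countP_cons]
    rw [List.pairwise_cons, List.pairwise_cons] at h
    obtain ⟨hp, hx, -⟩ := h
    have hpx := hp x (by simp)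
    congr 1
    · refine List.countP_congr fun y hy => ?_
      have := hx y hy
      simp only [decide_eq_true_eq, List.mem_cons]
      constructor
      · rintro ⟨h1, h2, h3⟩
        refine ⟨h1, .inr h2, ?_⟩
        rintro (h4 | h4)
        · omega
        · exact h3 h4
      · rintro ⟨h1, h2 | h2, h3⟩
        · exact absurd (.inr (.inl (by omega))) h3
        · exact ⟨h1, h2, fun h4 => h3 (.inr h4)⟩
    · have hL : ∀ z ≤ x, z ∉ L := fun z hz hz' => absurd (hx z hz') (by omega)
      have h1 := hL (x - 1) (by omega)
      have h2 := hL (x - 2) (by omega)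
      simp only [beq_iff_eq, decide_eq_true_eq, List.mem_cons, h1, h2, or_false, not_or]
      congr 1
      rw [eq_iff_iff]
      omega

/-- `SecondAt π x` says that the `x`-th position, counted from `1`, is a second occurrence. -/
def SecondAt {n : ℕ} (π : Fin (2*n) → Fin (2*n)) (x : ℕ) : Prop :=
  ∃ j, π j < j ∧ (j : ℕ) + 1 = x

/-- `BlockTwoAt π x` says that a block of length two ends at the `x`-th position, counted
from `1`. -/
def BlockTwoAt {n : ℕ} (π : Fin (2*n) → Fin (2*n)) (x : ℕ) : Prop :=
  SecondAt π x ∧ 2 ≤ x ∧ (x - 2 = 0 ∨ SecondAt π (x - 2)) ∧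
    ¬ (x - 1 = 0 ∨ SecondAt π (x - 1))

theorem count_two_blockLens {n : ℕ} (π : Fin (2*n) → Fin (2*n)) :
    (blockLens π).count 2 = ((Finset.range (2*n + 1)).filter (BlockTwoAt π)).card := by
  set L := (blockEnds π).map (fun j => (j : ℕ) + 1) with hL
  have hmem : ∀ x, x ∈ L ↔ SecondAt π x := by
    intro x
    simp [hL, blockEnds, SecondAt]
  have hL' : L = (blockEnds π).map (fun j : Fin (2*n) => j.val + 1) := by
    simp [hL, ← List.map_eq_flatMap]
  have hsorted : L.Pairwise (· < ·) := by
    rw [hL', List.pairwise_map]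
    refine (Finset.sortedLT_sort (Finset.univ.filter fun j => π j < j)).pairwise.imp ?_
    intro a b hab
    have : a.val < b.val := hab
    omega
  have hpos : ∀ x ∈ L, 0 < x := by
    intro x hx
    obtain ⟨j, -, rfl⟩ := (hmem x).1 hx
    omega
  rw [blockLens, ← hL, count_zipWith_sub_cons L 0 (List.pairwise_cons.2 ⟨hpos, hsorted⟩),
    List.countP_eq_length_filter,
    ← List.toFinset_card_of_nodup ((hsorted.imp fun h => h.ne).filter _)]
  congr 1
  ext x
  simp only [List.mem_toFinset, List.mem_filter, decide_eq_true_eq, List.mem_cons, hmem,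
    Finset.mem_filter, Finset.mem_range, BlockTwoAt]
  constructor
  · intro h
    obtain ⟨j, -, hj⟩ := h.1
    exact ⟨by omega, h⟩
  · exact fun h => h.2

theorem bcount_two (n : ℕ) :
    bcount n 2 = ∑ x ∈ Finset.range (2*n + 1), ((deals n).filter (BlockTwoAt · x)).card := by
  simp only [bcount, count_two_blockLens]
  exact Finset.sum_card_bipartiteAbove_eq_sum_card_bipartiteBelow BlockTwoAt

theorem secondAt_succ_iff {n : ℕ} {π : Fin (2*n) → Fin (2*n)} {x : ℕ} (hx : x < 2*n) :
    SecondAt π (x + 1) ↔ π ⟨x, hx⟩ < ⟨x, hx⟩ := by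
  constructor
  · rintro ⟨j, hj, e⟩
    obtain rfl : j = ⟨x, hx⟩ := Fin.ext (by simpa using e)
    exact hj
  · exact fun h => ⟨_, h, rfl⟩

theorem card_blockTwoAt_two {n : ℕ} (hn : 1 ≤ n) :
    (((deals n).filter (BlockTwoAt · 2)).card : ℝ) = (deals n).card / (2*n - 1) := by
  have h0 : 0 < 2*n := by omega
  have h1 : 1 < 2*n := by omega
  rw [← card_deals_pair_eq (a := ⟨1, h1⟩) (b := ⟨0, h0⟩) (by simp)]
  congr 2
  ext π
  rw [Finset.mem_filter, Finset.mem_filter, BlockTwoAt]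
  refine and_congr_right fun _ => ?_
  have e1 : SecondAt π 2 ↔ _ := secondAt_succ_iff h1
  have e0 : SecondAt π 1 ↔ _ := secondAt_succ_iff h0
  have hlt0 : ¬ (π ⟨0, h0⟩).val < 0 := by omega
  have hlt1 : (π ⟨1, h1⟩).val < 1 ↔ (π ⟨1, h1⟩).val = 0 := Nat.lt_one_iff
  rw [Fin.lt_def] at e0 e1
  simp [e1, e0, hlt0, hlt1, Fin.ext_iff]

theorem card_blockTwoAt_add_three {n k : ℕ} (hk : k + 2 < 2*n) :
    (((deals n).filter (BlockTwoAt · (k + 3))).card : ℝ) =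
      (k + k * (k - 1) * (2*n - 3 - k) / (2*n - 5)) *
        ((deals n).card / ((2*n - 1) * (2*n - 3))) := by
  rw [← card_deals_block (k := ⟨k, by omega⟩) (l := ⟨k + 1, by omega⟩) (m := ⟨k + 2, hk⟩)
    rfl rfl]
  congr 2
  ext π
  rw [Finset.mem_filter, Finset.mem_filter, BlockTwoAt]
  refine and_congr_right fun _ => ?_
  rw [secondAt_succ_iff (x := k + 2) hk, show k + 3 - 2 = k + 1 by omega,
    show k + 3 - 1 = k + 1 + 1 by omega, secondAt_succ_iff (x := k) (by omega),
    secondAt_succ_iff (x := k + 1) (by omega)]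
  grind

theorem sum_range_block_weights (M : ℕ) (c : ℝ) :
    ∑ k ∈ Finset.range M, ((k : ℝ) + k * (k - 1) * (c - k) / (c - 2)) =
      M * (M - 1) / 2 +
        M * (M - 1) * (M - 2) * (c / 3 - (3 * M - 1) / 12) / (c - 2) := by
  induction M with
  | zero => simp
  | succ M ih =>
    rw [Finset.sum_range_succ, ih]
    push_cast
    ring

theorem bcount_two_eq {n : ℕ} (hn : 1 ≤ n) :
    (bcount n 2 : ℝ) = (n^2 + 2) / (3 * (2*n - 1)) * (deals n).card := by
  have h1 : (2*n - 1 : ℝ) ≠ 0 := by simpa using two_mul_sub_ne_zero n (k := 1) (by decide)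
  have h3 : (2*n - 3 : ℝ) ≠ 0 := by simpa using two_mul_sub_ne_zero n (k := 3) (by decide)
  have h5 : (2*n - 5 : ℝ) ≠ 0 := by simpa using two_mul_sub_ne_zero n (k := 5) (by decide)
  have hz : ∀ x < 2, ((deals n).filter (BlockTwoAt · x)).card = 0 := by
    intro x hx
    rw [Finset.card_eq_zero, Finset.filter_eq_empty_iff]
    intro π _ h
    exact absurd h.2.1 (by omega)
  rw [bcount_two, show 2*n + 1 = (2*n - 2) + 1 + 1 + 1 by omega, Finset.sum_range_succ',
    Finset.sum_range_succ', Finset.sum_range_succ']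
  push_cast
  simp only [add_assoc, Nat.reduceAdd]
  rw [hz 0 (by omega), hz 1 (by omega), card_blockTwoAt_two hn,
    Finset.sum_congr rfl fun k hk => card_blockTwoAt_add_three
      (by have := Finset.mem_range.1 hk; omega), ← Finset.sum_mul]
  have hsum := sum_range_block_weights (2*n - 2) (2*n - 3)
  rw [show (2*n - 3 - 2 : ℝ) = 2*n - 5 by ring, Nat.cast_sub (by omega)] at hsum
  rw [hsum]
  push_cast
  field_simp
  ring

/-- For `n ≥ 1`, `eb(n,2) = (2n+1)/12 + 3/(4(2n-1))`; equivalently,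
`db(n,2) = 3/(4(2n-1))`. -/
theorem eb_two (n : ℕ) (hn : 1 ≤ n) :
    eb n 2 = (2*(n:ℝ)+1)/12 + 3/(4*(2*(n:ℝ)-1)) ∧
      db n 2 = 3/(4*(2*(n:ℝ)-1)) := by
  have h1 : (2*n - 1 : ℝ) ≠ 0 := by simpa using two_mul_sub_ne_zero n (k := 1) (by decide)
  have hcard : ((deals n).card : ℝ) ≠ 0 := by
    exact_mod_cast (deals_nonempty n).card_ne_zero
  have heb : eb n 2 = (2*(n:ℝ)+1)/12 + 3/(4*(2*(n:ℝ)-1)) := by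
    rw [eb, bcount_two_eq hn, mul_div_cancel_right₀ _ hcard]
    rw [div_add_div _ _ (by norm_num) (mul_ne_zero (by norm_num) h1),
      div_eq_div_iff (mul_ne_zero (by norm_num) h1)
        (mul_ne_zero (by norm_num) (mul_ne_zero (by norm_num) h1))]
    ring
  refine ⟨heb, ?_⟩
  rw [db, heb]
  push_cast
  ring
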